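/- arXiv:2405.13351 — 7 statements merged into one kernel-verified Lean document; each statement's English description precedes it below -/
import Mathlib

section
/- Let A = (a_1, …, a_n) be a finite nonempty family of points in ℝ^d and let C ⊂ ℝ^d be a finite nonempty set of centers with ∑_{i=1}^n D(a_i, C)² > 0. If a center c is chosen from A by D²-sampling with respect to C, i.e. Pr[c = a_i] = D(a_i, C)² / ∑_{j=1}^n D(a_j, C)², then the expected cost of A with respect to C ∪ {c} satisfies E[ ∑_{j=1}^n min(D(a_j, C)², ‖a_j − c‖²) ] ≤ 8 · Δ(A); equivalently, ∑_{i=1}^n D(a_i, C)² · ( ∑_{j=1}^n min(D(a_j, C)², ‖a_j − a_i‖²) ) ≤ 8 · Δ(A) · ∑_{i=1}^n D(a_i, C)². -/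
/-- The pairwise squared distances of a centered family sum to twice its size times its cost. -/
theorem sum_sum_norm_sub_sq_of_sum_eq_zero {ι E : Type*} [Fintype ι] [NormedAddCommGroup E]
    [InnerProductSpace ℝ E] (b : ι → E) (hb : ∑ i, b i = 0) :
    ∑ i, ∑ j, ‖b j - b i‖ ^ 2 = 2 * Fintype.card ι * ∑ i, ‖b i‖ ^ 2 := by
  have key (i : ι) : ∑ j, ‖b j - b i‖ ^ 2 = ∑ j, ‖b j‖ ^ 2 + Fintype.card ι * ‖b i‖ ^ 2 := by
    simp only [norm_sub_sq_real, Finset.sum_add_distrib, Finset.sum_sub_distrib,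
      ← Finset.mul_sum, ← sum_inner, hb, inner_zero_left, Finset.sum_const, Finset.card_univ,
      nsmul_eq_mul]
    ring
  simp only [key, Finset.sum_add_distrib, ← Finset.mul_sum, Finset.sum_const, Finset.card_univ,
    nsmul_eq_mul]
  ring

/-- The pairwise squared distances of a family sum to twice its size times its 1-means cost. -/
theorem sum_sum_norm_sub_sq {ι E : Type*} [Fintype ι] [Nonempty ι] [NormedAddCommGroup E]
    [InnerProductSpace ℝ E] (a : ι → E) (μ : E) (hμ : μ = (Fintype.card ι : ℝ)⁻¹ • ∑ i, a i) :
    ∑ i, ∑ j, ‖a j - a i‖ ^ 2 = 2 * Fintype.card ι * ∑ i, ‖a i - μ‖ ^ 2 := by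
  have hb : ∑ i, (a i - μ) = 0 := by
    have hcard : (Fintype.card ι : ℝ) ≠ 0 := Nat.cast_ne_zero.mpr Fintype.card_ne_zero
    rw [Finset.sum_sub_distrib, Finset.sum_const, Finset.card_univ, hμ,
      ← Nat.cast_smul_eq_nsmul ℝ, smul_inv_smul₀ hcard, sub_self]
  simpa using sum_sum_norm_sub_sq_of_sum_eq_zero (fun i => a i - μ) hb

/-- The distance to the nearest point of a finite set is nonnegative. -/
theorem inf'_norm_sub_nonneg {E : Type*} [SeminormedAddCommGroup E] (C : Finset E)
    (hC : C.Nonempty) (x : E) : 0 ≤ C.inf' hC (fun c => ‖x - c‖) :=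
  Finset.le_inf' _ _ fun _ _ => norm_nonneg _

/-- The distance to the nearest point of a finite set is 1-Lipschitz. -/
theorem inf'_norm_sub_le_add {E : Type*} [SeminormedAddCommGroup E] (C : Finset E)
    (hC : C.Nonempty) (x y : E) :
    C.inf' hC (fun c => ‖x - c‖) ≤ C.inf' hC (fun c => ‖y - c‖) + ‖x - y‖ := by
  obtain ⟨c, hc, h⟩ := Finset.exists_mem_eq_inf' hC (fun c => ‖y - c‖)
  rw [h, add_comm]
  exact (Finset.inf'_le _ hc).trans (norm_sub_le_norm_sub_add_norm_sub x y c)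

/-- Weighted averaging of truncated dissimilarities `r`, when the weights `s` satisfy a relaxed
triangle inequality with respect to `r`. -/
theorem card_mul_sum_mul_sum_min_le {ι : Type*} [Fintype ι] (s : ι → ℝ) (r : ι → ι → ℝ)
    (hs : ∀ i, 0 ≤ s i) (hr : ∀ i j, 0 ≤ r i j)
    (h : ∀ i k, s i ≤ 2 * s k + 2 * r k i) :
    Fintype.card ι * ∑ i, s i * ∑ j, min (s j) (r j i)
      ≤ 4 * (∑ i, s i) * ∑ i, ∑ j, r j i := by
  rw [Finset.mul_sum, Finset.mul_sum]
  refine Finset.sum_le_sum fun i _ => ?_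
  have havg : Fintype.card ι * s i ≤ 2 * ∑ k, s k + 2 * ∑ k, r k i := by
    have := Finset.sum_le_sum fun k (_ : k ∈ Finset.univ) => h i k
    simpa [Finset.sum_add_distrib, ← Finset.mul_sum] using this
  have hM : 0 ≤ ∑ j, min (s j) (r j i) :=
    Finset.sum_nonneg fun j _ => le_min (hs j) (hr j i)
  have hMs : ∑ j, min (s j) (r j i) ≤ ∑ j, s j := Finset.sum_le_sum fun _ _ => min_le_left _ _
  have hMr : ∑ j, min (s j) (r j i) ≤ ∑ j, r j i :=
    Finset.sum_le_sum fun _ _ => min_le_right _ _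
  have hS : 0 ≤ ∑ j, s j := hM.trans hMs
  have hR : 0 ≤ ∑ j, r j i := hM.trans hMr
  nlinarith [mul_le_mul_of_nonneg_right havg hM, mul_le_mul_of_nonneg_left hMr hS,
    mul_le_mul_of_nonneg_left hMs hR]

/-- **D²-sampling gives 8-approximation in expectation (Arthur–Vassilvitskii Lemma 3.2).**
If a center `c` is chosen from the family `a` by `D²`-sampling with respect to the
center set `C`, then the expected cost of `a` w.r.t. `C ∪ {c}` is at most `8 · Δ(A)`;
stated in the equivalent deterministic form obtained by multiplying through by the
normalizing constant `∑ i, D(a i, C)²`. -/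
theorem stmt_0 {d n : ℕ} (hn : 0 < n)
    (a : Fin n → EuclideanSpace ℝ (Fin d))
    (C : Finset (EuclideanSpace ℝ (Fin d))) (hC : C.Nonempty)
    (D : EuclideanSpace ℝ (Fin d) → ℝ)
    (hD : ∀ x, D x = C.inf' hC (fun c => ‖x - c‖))
    (μ : EuclideanSpace ℝ (Fin d)) (hμ : μ = (n : ℝ)⁻¹ • ∑ i, a i)
    (Δ : ℝ) (hΔ : Δ = ∑ i, ‖a i - μ‖ ^ 2)
    (hpos : 0 < ∑ i, D (a i) ^ 2) :
    ∑ i, D (a i) ^ 2 * (∑ j, min (D (a j) ^ 2) (‖a j - a i‖ ^ 2))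
      ≤ 8 * Δ * ∑ i, D (a i) ^ 2 := by
  have hnpos : (0 : ℝ) < n := Nat.cast_pos.mpr hn
  have : Nonempty (Fin n) := ⟨⟨0, hn⟩⟩
  have htri (i k : Fin n) : D (a i) ^ 2 ≤ 2 * D (a k) ^ 2 + 2 * ‖a k - a i‖ ^ 2 := by
    have h0 : 0 ≤ D (a i) := by rw [hD]; exact inf'_norm_sub_nonneg C hC _
    have h1 : D (a i) ≤ D (a k) + ‖a k - a i‖ := by
      rw [hD, hD, norm_sub_rev]; exact inf'_norm_sub_le_add C hC _ _
    nlinarith [pow_le_pow_left₀ h0 h1 2, sq_nonneg (D (a k) - ‖a k - a i‖)]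
  have hmain := card_mul_sum_mul_sum_min_le (fun i => D (a i) ^ 2)
    (fun j i => ‖a j - a i‖ ^ 2) (fun _ => sq_nonneg _) (fun _ _ => sq_nonneg _) htri
  rw [sum_sum_norm_sub_sq a μ (by simpa using hμ), ← hΔ, Fintype.card_fin] at hmain
  refine le_of_mul_le_mul_left (hmain.trans_eq ?_) hnpos
  ring
end

section
/- Let 0 < δ ≤ 1/2. Let A = (a_1, …, a_n) be a finite nonempty family of points in ℝ^d and let C ⊂ ℝ^d be a finite nonempty set of centers. Let 𝒟 : A → ℝ be δ-close to the distance to C, i.e. (1−δ)·D(a_i, C) ≤ 𝒟(a_i) ≤ (1+δ)·D(a_i, C) for every i, and suppose ∑_{i=1}^n 𝒟(a_i)² > 0. If a center c is chosen from A by 𝒟²-sampling, i.e. Pr[c = a_i] = 𝒟(a_i)² / ∑_{j=1}^n 𝒟(a_j)², then E[ ∑_{j=1}^n min(D(a_j, C)², ‖a_j − c‖²) ] ≤ 72 · Δ(A); equivalently, ∑_{i=1}^n 𝒟(a_i)² · ( ∑_{j=1}^n min(D(a_j, C)², ‖a_j − a_i‖²) ) ≤ 72 · Δ(A) · ∑_{i=1}^n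 𝒟(a_i)². -/
/-- The sum of all pairwise squared distances is `2n` times the sum of the squared distances to
the centroid. -/
theorem sum_sum_norm_sub_sq_eq {E ι : Type*} [NormedAddCommGroup E] [InnerProductSpace ℝ E]
    [Fintype ι] [Nonempty ι] (a : ι → E) (μ : E)
    (hμ : μ = (Fintype.card ι : ℝ)⁻¹ • ∑ i, a i) :
    ∑ i, ∑ j, ‖a j - a i‖ ^ 2 = 2 * Fintype.card ι * ∑ i, ‖a i - μ‖ ^ 2 := by
  have hcard : (Fintype.card ι : ℝ) ≠ 0 := by exact_mod_cast Fintype.card_ne_zero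
  have hsum : ∑ i, (a i - μ) = 0 := by
    rw [Finset.sum_sub_distrib, Finset.sum_const, Finset.card_univ, ← Nat.cast_smul_eq_nsmul ℝ,
      hμ, smul_inv_smul₀ hcard, sub_self]
  have hexpand : ∀ i j, ‖a j - a i‖ ^ 2
      = ‖a j - μ‖ ^ 2 - 2 * inner ℝ (a j - μ) (a i - μ) + ‖a i - μ‖ ^ 2 := fun i j => by
    rw [← norm_sub_sq_real, sub_sub_sub_cancel_right]
  simp only [hexpand, Finset.sum_add_distrib, Finset.sum_sub_distrib, ← Finset.mul_sum,
    ← sum_inner, hsum, inner_zero_left, Finset.sum_const, Finset.card_univ, nsmul_eq_mul]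
  ring

/-- Exact `D²`-sampling from a family, with respect to a nonnegative `1`-Lipschitz function `f`,
costs at most `4 / n` times the sum of all pairwise squared distances. -/
theorem card_mul_sum_sq_mul_sum_min_le {E ι : Type*} [SeminormedAddCommGroup E] [Fintype ι]
    (a : ι → E) (f : ι → ℝ) (hf : ∀ i, 0 ≤ f i) (hlip : ∀ i j, f i ≤ f j + ‖a j - a i‖) :
    Fintype.card ι * ∑ i, f i ^ 2 * ∑ j, min (f j ^ 2) (‖a j - a i‖ ^ 2)
      ≤ 4 * (∑ i, ∑ j, ‖a j - a i‖ ^ 2) * ∑ i, f i ^ 2 := by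
  set S := ∑ i, f i ^ 2
  have havg : ∀ i, Fintype.card ι * f i ^ 2 ≤ 2 * S + 2 * ∑ j, ‖a j - a i‖ ^ 2 := fun i => by
    calc Fintype.card ι * f i ^ 2 = ∑ _j : ι, f i ^ 2 := by simp
      _ ≤ ∑ j, (2 * f j ^ 2 + 2 * ‖a j - a i‖ ^ 2) := by
          refine Finset.sum_le_sum fun j _ => ?_
          have hsq := pow_le_pow_left₀ (hf i) (hlip i j) 2
          nlinarith [sq_nonneg (f j - ‖a j - a i‖)]
      _ = _ := by rw [Finset.sum_add_distrib, Finset.mul_sum, Finset.mul_sum]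
  have hbound : ∀ i, Fintype.card ι * (f i ^ 2 * ∑ j, min (f j ^ 2) (‖a j - a i‖ ^ 2))
      ≤ 4 * S * ∑ j, ‖a j - a i‖ ^ 2 := fun i => by
    have hS : 0 ≤ S := Finset.sum_nonneg fun i _ => sq_nonneg _
    have hN : 0 ≤ ∑ j, ‖a j - a i‖ ^ 2 := Finset.sum_nonneg fun j _ => sq_nonneg _
    have hM : 0 ≤ ∑ j, min (f j ^ 2) (‖a j - a i‖ ^ 2) :=
      Finset.sum_nonneg fun j _ => le_min (sq_nonneg _) (sq_nonneg _)
    have hMS : ∑ j, min (f j ^ 2) (‖a j - a i‖ ^ 2) ≤ S :=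
      Finset.sum_le_sum fun j _ => min_le_left _ _
    have hMN : ∑ j, min (f j ^ 2) (‖a j - a i‖ ^ 2) ≤ ∑ j, ‖a j - a i‖ ^ 2 :=
      Finset.sum_le_sum fun j _ => min_le_right _ _
    linarith [mul_le_mul_of_nonneg_right (havg i) hM, mul_le_mul_of_nonneg_left hMN hS,
      mul_le_mul_of_nonneg_left hMS hN]
  calc _ ≤ ∑ i, 4 * S * ∑ j, ‖a j - a i‖ ^ 2 := by
        rw [Finset.mul_sum]
        exact Finset.sum_le_sum fun i _ => hbound i
    _ = _ := by rw [← Finset.mul_sum]; ring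


/-- **Noisy D²-sampling gives 72-approximation in expectation (Lemma for δ-close distances).**
If the sampling distances `𝒟` are `δ`-close to the true distances to the center set `C`
(for `0 < δ ≤ 1/2`) and a center `c` is chosen from the family `a` by `𝒟²`-sampling,
then the expected cost of `a` w.r.t. `C ∪ {c}` is at most `72 · Δ(A)`; stated in the
equivalent deterministic form obtained by multiplying through by `∑ i, 𝒟(a i)²`. -/
theorem stmt_1 {d n : ℕ} (hn : 0 < n)
    (δ : ℝ) (hδ0 : 0 < δ) (hδ1 : δ ≤ 1 / 2)
    (a : Fin n → EuclideanSpace ℝ (Fin d))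
    (C : Finset (EuclideanSpace ℝ (Fin d))) (hC : C.Nonempty)
    (D : EuclideanSpace ℝ (Fin d) → ℝ)
    (hD : ∀ x, D x = C.inf' hC (fun c => ‖x - c‖))
    (𝒟 : Fin n → ℝ)
    (hclose : ∀ i, (1 - δ) * D (a i) ≤ 𝒟 i ∧ 𝒟 i ≤ (1 + δ) * D (a i))
    (μ : EuclideanSpace ℝ (Fin d)) (hμ : μ = (n : ℝ)⁻¹ • ∑ i, a i)
    (Δ : ℝ) (hΔ : Δ = ∑ i, ‖a i - μ‖ ^ 2)
    (hpos : 0 < ∑ i, 𝒟 i ^ 2) :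
    ∑ i, 𝒟 i ^ 2 * (∑ j, min (D (a j) ^ 2) (‖a j - a i‖ ^ 2))
      ≤ 72 * Δ * ∑ i, 𝒟 i ^ 2 := by
  have : NeZero n := ⟨hn.ne'⟩
  have hn' : (0 : ℝ) < n := by exact_mod_cast hn
  have hD0 : ∀ x, 0 ≤ D x := fun x => by
    rw [hD]
    exact Finset.le_inf' _ _ fun c _ => norm_nonneg _
  have hlip : ∀ i j, D (a i) ≤ D (a j) + ‖a j - a i‖ := fun i j => by
    rw [hD, hD, norm_sub_rev (a j)]
    exact inf'_norm_sub_le_add C hC _ _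
  have hΔ0 : 0 ≤ Δ := hΔ ▸ Finset.sum_nonneg fun i _ => sq_nonneg _
  have hupper : ∀ i, 𝒟 i ^ 2 ≤ 9 / 4 * D (a i) ^ 2 := fun i => by
    have h0 : 0 ≤ 𝒟 i := (mul_nonneg (by linarith) (hD0 _)).trans (hclose i).1
    have h1 : 𝒟 i ≤ 3 / 2 * D (a i) := (hclose i).2.trans
      (mul_le_mul_of_nonneg_right (by linarith) (hD0 _))
    linarith [pow_le_pow_left₀ h0 h1 2]
  have hlower : ∀ i, D (a i) ^ 2 ≤ 4 * 𝒟 i ^ 2 := fun i => by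
    have h1 : 1 / 2 * D (a i) ≤ 𝒟 i := (mul_le_mul_of_nonneg_right (by linarith) (hD0 _)).trans
      (hclose i).1
    linarith [pow_le_pow_left₀ (mul_nonneg (by norm_num) (hD0 _)) h1 2]
  have hexact : ∑ i, D (a i) ^ 2 * (∑ j, min (D (a j) ^ 2) (‖a j - a i‖ ^ 2))
      ≤ 8 * Δ * ∑ i, D (a i) ^ 2 := by
    have h := card_mul_sum_sq_mul_sum_min_le a (fun i => D (a i)) (fun i => hD0 _) hlip
    rw [sum_sum_norm_sub_sq_eq a μ (by rw [hμ, Fintype.card_fin]), ← hΔ, Fintype.card_fin] at h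
    refine le_of_mul_le_mul_left (h.trans_eq ?_) hn'
    ring
  calc _ ≤ ∑ i, 9 / 4 * (D (a i) ^ 2 * ∑ j, min (D (a j) ^ 2) (‖a j - a i‖ ^ 2)) := by
        refine Finset.sum_le_sum fun i _ => ?_
        rw [← mul_assoc]
        exact mul_le_mul_of_nonneg_right (hupper i)
          (Finset.sum_nonneg fun j _ => le_min (sq_nonneg _) (sq_nonneg _))
    _ ≤ 9 / 4 * (8 * Δ * ∑ i, D (a i) ^ 2) := by
        rw [← Finset.mul_sum]
        exact mul_le_mul_of_nonneg_left hexact (by norm_num)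
    _ ≤ 9 / 4 * (8 * Δ * (4 * ∑ i, 𝒟 i ^ 2)) := by
        rw [Finset.mul_sum _ _ (4 : ℝ)]
        gcongr with i
        exact hlower i
    _ = _ := by ring
end

section
/- Let n ≥ 1, let x_1, …, x_n ∈ ℝ^d and c_1, …, c_n ∈ ℝ^d, and let m = (1/n)∑_{i=1}^n x_i and m' = (1/n)∑_{i=1}^n c_i. Let 0 < ε ≤ 2, let k ≥ 1 be an integer, and let T ≥ 0 be a real number such that ∑_{i=1}^n ‖x_i − c_i‖² ≤ (ε/(6k))·T. If a point m'' ∈ ℝ^d satisfies ∑_{i=1}^n ‖c_i − m''‖² ≤ (1 + ε/8)·∑_{i=1}^n ‖c_i − m'‖², then ∑_{i=1}^n ‖x_i − m''‖² ≤ (1 + ε/2)·∑_{i=1}^n ‖x_i − m‖² + (ε/(2k))·T. -/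
/-- The sum of squared distances to `p` splits into the one to the mean `m` plus `n‖m - p‖²`. -/
theorem sum_norm_sub_sq_eq_of_mean {E : Type*} [NormedAddCommGroup E] [InnerProductSpace ℝ E]
    {n : ℕ} (hn : n ≠ 0) (x : Fin n → E) {m : E} (hm : m = (n : ℝ)⁻¹ • ∑ i, x i) (p : E) :
    ∑ i, ‖x i - p‖ ^ 2 = ∑ i, ‖x i - m‖ ^ 2 + n * ‖m - p‖ ^ 2 := by
  have hn' : (n : ℝ) ≠ 0 := Nat.cast_ne_zero.mpr hn
  have hzero : ∑ i, (x i - m) = 0 := by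
    rw [Finset.sum_sub_distrib, Finset.sum_const, Finset.card_univ, Fintype.card_fin,
      ← Nat.cast_smul_eq_nsmul ℝ, hm, smul_inv_smul₀ hn', sub_self]
  have hsplit (i : Fin n) :
      ‖x i - p‖ ^ 2 = ‖x i - m‖ ^ 2 + 2 * inner ℝ (x i - m) (m - p) + ‖m - p‖ ^ 2 := by
    rw [← norm_add_sq_real, sub_add_sub_cancel]
  simp only [hsplit, Finset.sum_add_distrib, ← Finset.mul_sum, ← sum_inner, hzero,
    inner_zero_left, Finset.sum_const, Finset.card_univ, Fintype.card_fin, nsmul_eq_mul]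
  ring

theorem norm_add_sq_le_two_mul {E : Type*} [SeminormedAddCommGroup E] (u v : E) :
    ‖u + v‖ ^ 2 ≤ 2 * (‖u‖ ^ 2 + ‖v‖ ^ 2) :=
  (pow_le_pow_left₀ (norm_nonneg _) (norm_add_le u v) 2).trans add_sq_le


/-- **Case-I lemma.** If `∑ ‖x i − c i‖² ≤ (ε/(6k))·T` and `m''` is a `(1 + ε/8)`-approximate
1-means center for the family `c`, then `m''` is a good center for the family `x`:
`∑ ‖x i − m''‖² ≤ (1 + ε/2)·∑ ‖x i − m‖² + (ε/(2k))·T`. -/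
theorem stmt_5 {d n : ℕ} (hn : 1 ≤ n)
    (x c : Fin n → EuclideanSpace ℝ (Fin d))
    (m m' : EuclideanSpace ℝ (Fin d))
    (hm : m = (n : ℝ)⁻¹ • ∑ i, x i) (hm' : m' = (n : ℝ)⁻¹ • ∑ i, c i)
    (ε : ℝ) (hε0 : 0 < ε) (hε2 : ε ≤ 2)
    (k : ℕ) (hk : 1 ≤ k)
    (T : ℝ) (hT0 : 0 ≤ T)
    (hsmall : ∑ i, ‖x i - c i‖ ^ 2 ≤ (ε / (6 * k)) * T)
    (m'' : EuclideanSpace ℝ (Fin d))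
    (hgood : ∑ i, ‖c i - m''‖ ^ 2 ≤ (1 + ε / 8) * ∑ i, ‖c i - m'‖ ^ 2) :
    ∑ i, ‖x i - m''‖ ^ 2 ≤ (1 + ε / 2) * ∑ i, ‖x i - m‖ ^ 2 + (ε / (2 * k)) * T := by
  have hn0 : n ≠ 0 := by omega
  have hx := sum_norm_sub_sq_eq_of_mean hn0 x hm m''
  have hc := sum_norm_sub_sq_eq_of_mean hn0 c hm' m''
  have hcm := sum_norm_sub_sq_eq_of_mean hn0 c hm' m
  have hd := sum_norm_sub_sq_eq_of_mean hn0 (fun i => x i - c i) (m := m - m')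
    (by rw [hm, hm', Finset.sum_sub_distrib, smul_sub]) 0
  simp only [sub_zero] at hd
  have hd0 : 0 ≤ ∑ i, ‖x i - c i - (m - m')‖ ^ 2 := by positivity
  have hcm0 : 0 ≤ (n : ℝ) * ‖m' - m‖ ^ 2 := by positivity
  have hD0 : 0 ≤ ∑ i, ‖x i - c i‖ ^ 2 := by positivity
  have hcx : ∑ i, ‖c i - m‖ ^ 2 ≤ 2 * (∑ i, ‖x i - c i‖ ^ 2 + ∑ i, ‖x i - m‖ ^ 2) := by
    rw [← Finset.sum_add_distrib, Finset.mul_sum]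
    refine Finset.sum_le_sum fun i _ => ?_
    rw [norm_sub_rev (x i) (c i), ← sub_add_sub_cancel (c i) (x i) m]
    exact norm_add_sq_le_two_mul _ _
  have hmm : (n : ℝ) * ‖m - m''‖ ^ 2 ≤ n * (2 * (‖m - m'‖ ^ 2 + ‖m' - m''‖ ^ 2)) := by
    rw [← sub_add_sub_cancel m m' m'']
    gcongr
    exact norm_add_sq_le_two_mul _ _
  have hT : ε / (2 * k) * T = 3 * (ε / (6 * k) * T) := by
    have hk0 : (k : ℝ) ≠ 0 := by positivity
    field_simp
    ring
  have hC : ∑ i, ‖c i - m'‖ ^ 2 ≤ 2 * (∑ i, ‖x i - c i‖ ^ 2 + ∑ i, ‖x i - m‖ ^ 2) := by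
    linarith
  have hεC := mul_le_mul_of_nonneg_left hC hε0.le
  have hεD := mul_le_mul_of_nonneg_right hε2 hD0
  rw [hT]
  linarith
end

section
/- Let X = (x_1, …, x_n) be a finite nonempty family of points in ℝ^d, let C ⊂ ℝ^d be a finite nonempty set of centers, and let 0 < ε ≤ 1. Let R ≥ 0 satisfy R² = (ε²/41)·Φ(C, X)/n, and let n̄ = #{ i ∈ [n] : D(x_i, C) ≤ R }. Then Δ(X) ≥ (16·n̄/ε²)·R². -/
open Classical

/-- **Parallel axis identity** for the sum of squared distances to a point. -/
theorem sum_norm_sub_sq_eq_add_card_mul {E : Type*} [NormedAddCommGroup E] [InnerProductSpace ℝ E]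
    {n : ℕ} (hn : 0 < n) (x : Fin n → E) (c : E) :
    ∑ i, ‖x i - c‖ ^ 2 = ∑ i, ‖x i - (n : ℝ)⁻¹ • ∑ j, x j‖ ^ 2
      + n * ‖(n : ℝ)⁻¹ • ∑ j, x j - c‖ ^ 2 := by
  have hn' : (n : ℝ) ≠ 0 := by positivity
  set μ := (n : ℝ)⁻¹ • ∑ j, x j with hμ
  have hzero : ∑ i, (x i - μ) = 0 := by
    rw [Finset.sum_sub_distrib, Finset.sum_const, Finset.card_univ, Fintype.card_fin,
      ← Nat.cast_smul_eq_nsmul ℝ, hμ, smul_inv_smul₀ hn', sub_self]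
  have hcross : ∑ i, inner ℝ (x i - μ) (μ - c) = 0 := by
    rw [← sum_inner, hzero, inner_zero_left]
  have hpoint : ∀ i, ‖x i - c‖ ^ 2
      = ‖x i - μ‖ ^ 2 + 2 * inner ℝ (x i - μ) (μ - c) + ‖μ - c‖ ^ 2 := fun i => by
    rw [← norm_add_sq_real, sub_add_sub_cancel]
  simp_rw [hpoint]
  rw [Finset.sum_add_distrib, Finset.sum_add_distrib, ← Finset.mul_sum, hcross]
  simp

/-- The distance to the nearest point of a finite set is 1-Lipschitz. -/
theorem inf'_norm_sub_le_norm_sub_add {E : Type*} [SeminormedAddCommGroup E]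
    (C : Finset E) (hC : C.Nonempty) (y z : E) :
    C.inf' hC (fun c => ‖y - c‖) ≤ ‖z - y‖ + C.inf' hC (fun c => ‖z - c‖) := by
  obtain ⟨c, hc, hzc⟩ := C.exists_mem_eq_inf' hC (fun c => ‖z - c‖)
  rw [hzc, norm_sub_rev z y]
  exact (C.inf'_le _ hc).trans (norm_sub_le_norm_sub_add_norm_sub y z c)

/-- **Lower bound on the optimal 1-means cost in terms of the number of near points.**
With `R² = (ε²/41)·Φ(C, X)/n` and `n̄` the number of points of `X` within distance `R`
of the center set `C`, we have `Δ(X) ≥ (16·n̄/ε²)·R²`. -/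
theorem stmt_6 {d n : ℕ} (hn : 0 < n)
    (x : Fin n → EuclideanSpace ℝ (Fin d))
    (C : Finset (EuclideanSpace ℝ (Fin d))) (hC : C.Nonempty)
    (D : EuclideanSpace ℝ (Fin d) → ℝ)
    (hD : ∀ y, D y = C.inf' hC (fun c => ‖y - c‖))
    (ε : ℝ) (hε0 : 0 < ε) (hε1 : ε ≤ 1)
    (R : ℝ) (hR0 : 0 ≤ R)
    (hR : R ^ 2 = (ε ^ 2 / 41) * (∑ i, D (x i) ^ 2) / n)
    (μ : EuclideanSpace ℝ (Fin d)) (hμ : μ = (n : ℝ)⁻¹ • ∑ i, x i)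
    (Δ : ℝ) (hΔ : Δ = ∑ i, ‖x i - μ‖ ^ 2)
    (nbar : ℕ) (hnbar : nbar = (Finset.univ.filter fun i => D (x i) ≤ R).card) :
    (16 * nbar / ε ^ 2) * R ^ 2 ≤ Δ := by
  have hn' : (0 : ℝ) < n := by exact_mod_cast hn
  have hDnonneg : ∀ y, 0 ≤ D y := fun y => by
    rw [hD]
    exact Finset.le_inf' _ _ fun c _ => norm_nonneg _
  have hcost : ∑ i, D (x i) ^ 2 ≤ Δ + n * D μ ^ 2 := by
    obtain ⟨c, hc, hμc⟩ := C.exists_mem_eq_inf' hC (fun c => ‖μ - c‖)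
    rw [hD μ, hμc, hΔ, hμ, ← sum_norm_sub_sq_eq_add_card_mul hn x c]
    refine Finset.sum_le_sum fun i _ => pow_le_pow_left₀ (hDnonneg _) ?_ 2
    rw [hD]
    exact C.inf'_le _ hc
  obtain ⟨T, hT⟩ : ∃ T, T = R / ε := ⟨_, rfl⟩
  have hRT : R = ε * T := by rw [hT]; field_simp
  have hT0 : 0 ≤ T := hT ▸ div_nonneg hR0 hε0.le
  have hR_le : R ≤ T := hRT ▸ mul_le_of_le_one_left hT0 hε1
  have hΦ : ∑ i, D (x i) ^ 2 = 41 * n * T ^ 2 := by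
    rw [hT, div_pow, hR]
    field_simp
  have hgoal : 16 * nbar / ε ^ 2 * R ^ 2 = nbar * (16 * T ^ 2) := by
    rw [hRT]
    field_simp
  have hnbar_le : (nbar : ℝ) ≤ n := by
    rw [hnbar]
    exact_mod_cast (Finset.card_filter_le _ _).trans_eq (by simp)
  rw [hgoal]
  by_contra! hlt
  have hDμ : 5 * T ≤ D μ := by
    refine (pow_le_pow_iff_left₀ (by positivity) (hDnonneg μ) two_ne_zero).mp ?_
    have hle : (nbar : ℝ) * (16 * T ^ 2) ≤ n * (16 * T ^ 2) := by gcongr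
    refine le_of_mul_le_mul_left ?_ hn'
    linarith
  refine hlt.not_ge ?_
  calc (nbar : ℝ) * (16 * T ^ 2)
      = ∑ i with D (x i) ≤ R, 16 * T ^ 2 := by
        rw [Finset.sum_const, nsmul_eq_mul, hnbar]
    _ ≤ ∑ i with D (x i) ≤ R, ‖x i - μ‖ ^ 2 := by
        refine Finset.sum_le_sum fun i hi => ?_
        have hnear : D (x i) ≤ R := (Finset.mem_filter.mp hi).2
        have hlip : D μ ≤ ‖x i - μ‖ + D (x i) := by
          rw [hD, hD]
          exact inf'_norm_sub_le_norm_sub_add C hC μ (x i)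
        have hfar : 4 * T ≤ ‖x i - μ‖ := by linarith
        calc 16 * T ^ 2 = (4 * T) ^ 2 := by ring
          _ ≤ ‖x i - μ‖ ^ 2 := by gcongr
    _ ≤ Δ := by
        rw [hΔ]
        exact Finset.sum_le_sum_of_subset_of_nonneg (Finset.filter_subset _ _)
          fun _ _ _ => by positivity
end

section
/- Let X = (x_1, …, x_n) be a finite nonempty family of points in ℝ^d, let C ⊂ ℝ^d be a finite nonempty set of centers, let 0 < ε ≤ 1, and let R ≥ 0 satisfy R² = (ε²/41)·Φ(C, X)/n. For each i, let c(x_i) ∈ C be a center of C nearest to x_i, and define y_i = c(x_i) if D(x_i, C) ≤ R and y_i = x_i otherwise. Let m' = (1/n)∑_i y_i and n̄ = #{ i ∈ [n] : D(x_i, C) ≤ R }. Then ∑_{i=1}^n ‖y_i − m'‖² ≤ 4·n̄·R² + 2·Δ(X). -/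
open Classical

/-- The centroid minimizes the sum of squared distances to a finite family. -/
theorem sum_norm_sub_centroid_sq_le {ι E : Type*} [Fintype ι] [NormedAddCommGroup E]
    [InnerProductSpace ℝ E] (y : ι → E) (m a : E)
    (hm : (Fintype.card ι : ℝ) • m = ∑ i, y i) :
    ∑ i, ‖y i - m‖ ^ 2 ≤ ∑ i, ‖y i - a‖ ^ 2 := by
  have hexp : ∀ i, ‖y i - a‖ ^ 2 =
      ‖y i - m‖ ^ 2 + 2 * inner ℝ (y i - m) (m - a) + ‖m - a‖ ^ 2 := fun i => by
    rw [← norm_add_sq_real, sub_add_sub_cancel]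
  have hcross : ∑ i, inner ℝ (y i - m) (m - a) = 0 := by
    rw [← sum_inner, Finset.sum_sub_distrib, ← hm]
    simp [← Nat.cast_smul_eq_nsmul ℝ]
  simp_rw [hexp, Finset.sum_add_distrib, ← Finset.mul_sum, hcross]
  have : 0 ≤ ∑ _i : ι, ‖m - a‖ ^ 2 := by positivity
  linarith

/-- Relaxed triangle inequality for squared norms. -/
theorem norm_sub_sq_le_two_mul_add {E : Type*} [SeminormedAddCommGroup E] (u v w : E) :
    ‖u - w‖ ^ 2 ≤ 2 * ‖v - u‖ ^ 2 + 2 * ‖v - w‖ ^ 2 := by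
  have h := norm_sub_le_norm_sub_add_norm_sub u v w
  rw [norm_sub_rev u v] at h
  nlinarith [norm_nonneg (u - w), sq_nonneg (‖v - u‖ - ‖v - w‖)]

/-- **Cost of the collapsed family.** If `y` is obtained from `x` by replacing each point
within distance `R` of the center set `C` by its nearest center, then the optimal 1-means
cost of `y` satisfies `Δ(X') ≤ 4·n̄·R² + 2·Δ(X)`, where `n̄` is the number of collapsed
(near) points. -/
theorem stmt_8 {d n : ℕ} (hn : 0 < n)
    (x : Fin n → EuclideanSpace ℝ (Fin d))
    (C : Finset (EuclideanSpace ℝ (Fin d))) (hC : C.Nonempty)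
    (D : EuclideanSpace ℝ (Fin d) → ℝ)
    (hD : ∀ z, D z = C.inf' hC (fun c => ‖z - c‖))
    (ε : ℝ) (hε0 : 0 < ε) (hε1 : ε ≤ 1)
    (R : ℝ) (hR0 : 0 ≤ R)
    (hR : R ^ 2 = (ε ^ 2 / 41) * (∑ i, D (x i) ^ 2) / n)
    (c : Fin n → EuclideanSpace ℝ (Fin d))
    (hc : ∀ i, c i ∈ C ∧ ‖x i - c i‖ = D (x i))
    (y : Fin n → EuclideanSpace ℝ (Fin d))
    (hy : ∀ i, y i = if D (x i) ≤ R then c i else x i)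
    (μ m' : EuclideanSpace ℝ (Fin d))
    (hμ : μ = (n : ℝ)⁻¹ • ∑ i, x i) (hm' : m' = (n : ℝ)⁻¹ • ∑ i, y i)
    (Δ : ℝ) (hΔ : Δ = ∑ i, ‖x i - μ‖ ^ 2)
    (nbar : ℕ) (hnbar : nbar = (Finset.univ.filter fun i => D (x i) ≤ R).card) :
    ∑ i, ‖y i - m'‖ ^ 2 ≤ 4 * nbar * R ^ 2 + 2 * Δ := by
  have hn' : (n : ℝ) ≠ 0 := by positivity
  have hcentroid := sum_norm_sub_centroid_sq_le y m' μ (by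
    rw [hm', Fintype.card_fin, smul_inv_smul₀ hn'])
  have hmove : ∀ i, ‖x i - y i‖ ^ 2 ≤ if D (x i) ≤ R then R ^ 2 else 0 := fun i => by
    rw [hy i]
    split_ifs with h
    · rw [← (hc i).2] at h
      gcongr
    · simp
  have hmoved : ∑ i, ‖x i - y i‖ ^ 2 ≤ nbar * R ^ 2 := by
    refine (Finset.sum_le_sum fun i _ => hmove i).trans_eq ?_
    rw [← Finset.sum_filter, Finset.sum_const, nsmul_eq_mul, hnbar]
  have htri : ∑ i, ‖y i - μ‖ ^ 2 ≤ 2 * ∑ i, ‖x i - y i‖ ^ 2 + 2 * Δ := by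
    rw [hΔ, Finset.mul_sum, Finset.mul_sum, ← Finset.sum_add_distrib]
    exact Finset.sum_le_sum fun i _ => norm_sub_sq_le_two_mul_add (y i) (x i) μ
  have : 0 ≤ (nbar : ℝ) * R ^ 2 := by positivity
  linarith
end

section
/- Let V be a finite nonempty family of points in ℝ^d, let C ⊂ ℝ^d be a finite nonempty set of centers with Φ(C, V) > 0, and let X be a subfamily of V of size n ≥ 1. Let α ≥ 1, let k ≥ 1 be an integer, let 0 < ε ≤ 1/2 and 0 ≤ δ ≤ 1/15, and let 𝒟 : V → ℝ_{≥0} be δ-close to D(·, C). Suppose Φ(C, X) > (ε/(6αk))·Φ(C, V) (Case II). Let R ≥ 0 satisfy R² = (ε²/41)·Φ(C, X)/n and let X_far = { x ∈ X : D(x, C) > R }. Then the probability that a 𝒟²-sampled point lands in X_far satisfies ∑_{p ∈ X_far} 𝒟(p)² / ∑_{q ∈ V} 𝒟(q)² ≥ ε/(8αk). -/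
open Classical

/-- The points at which a function exceeds `r` carry all but at most `n * r ^ 2` of its sum of
squares. -/
theorem sum_sq_sub_card_mul_le_sum_filter_lt {κ : Type*} [Fintype κ] {f : κ → ℝ} (hf : ∀ i, 0 ≤ f i)
    (r : ℝ) :
    ∑ i, f i ^ 2 - Fintype.card κ * r ^ 2 ≤
      ∑ i ∈ Finset.univ.filter fun i => r < f i, f i ^ 2 := by
  have hnear : ∑ i ∈ Finset.univ.filter (fun i => ¬ r < f i), f i ^ 2 ≤
      Fintype.card κ * r ^ 2 := by
    calc ∑ i ∈ Finset.univ.filter (fun i => ¬ r < f i), f i ^ 2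
        ≤ ∑ i ∈ Finset.univ.filter (fun i => ¬ r < f i), r ^ 2 := by
          refine Finset.sum_le_sum fun i hi => ?_
          exact pow_le_pow_left₀ (hf i) (not_lt.mp (Finset.mem_filter.mp hi).2) 2
      _ ≤ ∑ _i : κ, r ^ 2 :=
          Finset.sum_le_sum_of_subset_of_nonneg (Finset.filter_subset _ _)
            fun _ _ _ => sq_nonneg r
      _ = Fintype.card κ * r ^ 2 := by simp
  have := Finset.sum_filter_add_sum_filter_not Finset.univ (fun i => r < f i) fun i => f i ^ 2
  linarith

/-- **Far points are sampled with decent total probability (first part of Lemma on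
𝒟²-sampling in Case II).** If `Φ(C, X) > (ε/(6αk))·Φ(C, V)`, then the total
`𝒟²`-sampling probability of the far points of `X` (those at distance more than `R`
from `C`) is at least `ε/(8αk)`. -/
theorem stmt_10 {d N n : ℕ} (hN : 0 < N) (hn : 0 < n)
    (V : Fin N → EuclideanSpace ℝ (Fin d))
    (C : Finset (EuclideanSpace ℝ (Fin d))) (hC : C.Nonempty)
    (D : EuclideanSpace ℝ (Fin d) → ℝ)
    (hD : ∀ z, D z = C.inf' hC (fun c => ‖z - c‖))
    (hΦV : 0 < ∑ q, D (V q) ^ 2)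
    (ι : Fin n ↪ Fin N) (x : Fin n → EuclideanSpace ℝ (Fin d))
    (hx : ∀ i, x i = V (ι i))
    (α : ℝ) (hα : 1 ≤ α) (k : ℕ) (hk : 1 ≤ k)
    (ε : ℝ) (hε0 : 0 < ε) (hε1 : ε ≤ 1 / 2)
    (δ : ℝ) (hδ0 : 0 ≤ δ) (hδ1 : δ ≤ 1 / 15)
    (𝒟 : Fin N → ℝ) (h𝒟0 : ∀ q, 0 ≤ 𝒟 q)
    (hclose : ∀ q, (1 - δ) * D (V q) ≤ 𝒟 q ∧ 𝒟 q ≤ (1 + δ) * D (V q))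
    (hcase2 : (ε / (6 * α * k)) * ∑ q, D (V q) ^ 2 < ∑ i, D (x i) ^ 2)
    (R : ℝ) (hR0 : 0 ≤ R)
    (hR : R ^ 2 = (ε ^ 2 / 41) * (∑ i, D (x i) ^ 2) / n) :
    ε / (8 * α * k) ≤
      (∑ i ∈ Finset.univ.filter fun i => R < D (x i), 𝒟 (ι i) ^ 2) /
        ∑ q, 𝒟 q ^ 2 := by
  have hD0 : ∀ z, 0 ≤ D z := fun z => by
    rw [hD]
    exact Finset.le_inf' _ _ fun c _ => norm_nonneg _
  have hlow : ∀ q, 196 / 225 * D (V q) ^ 2 ≤ 𝒟 q ^ 2 := fun q => by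
    have h : 14 / 15 * D (V q) ≤ 𝒟 q :=
      (mul_le_mul_of_nonneg_right (by linarith) (hD0 _)).trans (hclose q).1
    calc 196 / 225 * D (V q) ^ 2 = (14 / 15 * D (V q)) ^ 2 := by ring
      _ ≤ 𝒟 q ^ 2 := pow_le_pow_left₀ (mul_nonneg (by norm_num) (hD0 _)) h 2
  have hupp : ∀ q, 𝒟 q ^ 2 ≤ 256 / 225 * D (V q) ^ 2 := fun q => by
    have h : 𝒟 q ≤ 16 / 15 * D (V q) :=
      (hclose q).2.trans (mul_le_mul_of_nonneg_right (by linarith) (hD0 _))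
    calc 𝒟 q ^ 2 ≤ (16 / 15 * D (V q)) ^ 2 := pow_le_pow_left₀ (h𝒟0 q) h 2
      _ = 256 / 225 * D (V q) ^ 2 := by ring
  have htotal_low : 196 / 225 * ∑ q, D (V q) ^ 2 ≤ ∑ q, 𝒟 q ^ 2 := by
    rw [Finset.mul_sum]
    exact Finset.sum_le_sum fun q _ => hlow q
  have htotal_upp : ∑ q, 𝒟 q ^ 2 ≤ 256 / 225 * ∑ q, D (V q) ^ 2 := by
    rw [Finset.mul_sum]
    exact Finset.sum_le_sum fun q _ => hupp q
  have hfar : 196 / 225 * (∑ i ∈ Finset.univ.filter fun i => R < D (x i), D (x i) ^ 2) ≤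
      ∑ i ∈ Finset.univ.filter fun i => R < D (x i), 𝒟 (ι i) ^ 2 := by
    rw [Finset.mul_sum]
    exact Finset.sum_le_sum fun i _ => hx i ▸ hlow (ι i)
  have hdrop := sum_sq_sub_card_mul_le_sum_filter_lt (fun i => hD0 (x i)) R
  have hn' : (n : ℝ) ≠ 0 := by positivity
  have hnR : (Fintype.card (Fin n) : ℝ) * R ^ 2 = ε ^ 2 / 41 * ∑ i, D (x i) ^ 2 := by
    rw [Fintype.card_fin, hR, mul_div_cancel₀ _ hn']
  have hΦX : 0 ≤ ∑ i, D (x i) ^ 2 := Finset.sum_nonneg fun _ _ => sq_nonneg _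
  have hnR_le : ε ^ 2 / 41 * ∑ i, D (x i) ^ 2 ≤ 1 / 164 * ∑ i, D (x i) ^ 2 :=
    mul_le_mul_of_nonneg_right (by nlinarith) hΦX
  have hk0 : (0 : ℝ) < k := by exact_mod_cast hk
  have hα0 : 0 < α := by linarith
  have hprob : 0 < ε / (8 * α * k) := by positivity
  have hratio : ε / (6 * α * k) = 4 / 3 * (ε / (8 * α * k)) := by
    field_simp
    norm_num
  rw [hratio] at hcase2
  rw [le_div_iff₀ (by linarith)]
  have hscaled := mul_le_mul_of_nonneg_left htotal_upp hprob.le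
  have hpos := mul_pos hprob hΦV
  linarith
end

section
/- Let V be a finite nonempty family of points in ℝ^d, let C ⊂ ℝ^d be a finite nonempty set of centers with Φ(C, V) > 0, and let X be a subfamily of V of size n ≥ 1. Let α ≥ 1, let k ≥ 1 be an integer, let ε > 0 and 0 ≤ δ < 1, and let 𝒟 : V → ℝ_{≥0} be δ-close to D(·, C). Suppose Φ(C, X) > (ε/(6αk))·Φ(C, V) (Case II). Let R ≥ 0 satisfy R² = (ε²/41)·Φ(C, X)/n and let X_far = { x ∈ X : D(x, C) > R }. Then for every point p ∈ X_far, the 𝒟²-sampling probability of p satisfies 𝒟(p)² / ∑_{q ∈ V} 𝒟(q)² ≥ (1−δ)⁴·ε³ / (246·α·k·n). -/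
open Classical

/-- **Each far point is sampled with decent probability (second part of Lemma on
𝒟²-sampling in Case II).** If `Φ(C, X) > (ε/(6αk))·Φ(C, V)`, then every far point
`p ∈ X_far` (i.e. `D(p, C) > R`) has `𝒟²`-sampling probability at least
`(1−δ)⁴·ε³/(246·α·k·n)`. -/
theorem stmt_11 {d N n : ℕ} (hN : 0 < N) (hn : 0 < n)
    (V : Fin N → EuclideanSpace ℝ (Fin d))
    (C : Finset (EuclideanSpace ℝ (Fin d))) (hC : C.Nonempty)
    (D : EuclideanSpace ℝ (Fin d) → ℝ)
    (hD : ∀ z, D z = C.inf' hC (fun c => ‖z - c‖))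
    (hΦV : 0 < ∑ q, D (V q) ^ 2)
    (ι : Fin n ↪ Fin N) (x : Fin n → EuclideanSpace ℝ (Fin d))
    (hx : ∀ i, x i = V (ι i))
    (α : ℝ) (hα : 1 ≤ α) (k : ℕ) (hk : 1 ≤ k)
    (ε : ℝ) (hε0 : 0 < ε)
    (δ : ℝ) (hδ0 : 0 ≤ δ) (hδ1 : δ < 1)
    (𝒟 : Fin N → ℝ) (h𝒟0 : ∀ q, 0 ≤ 𝒟 q)
    (hclose : ∀ q, (1 - δ) * D (V q) ≤ 𝒟 q ∧ 𝒟 q ≤ (1 + δ) * D (V q))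
    (hcase2 : (ε / (6 * α * k)) * ∑ q, D (V q) ^ 2 < ∑ i, D (x i) ^ 2)
    (R : ℝ) (hR0 : 0 ≤ R)
    (hR : R ^ 2 = (ε ^ 2 / 41) * (∑ i, D (x i) ^ 2) / n) :
    ∀ i : Fin n, R < D (x i) →
      (1 - δ) ^ 4 * ε ^ 3 / (246 * α * k * n) ≤ 𝒟 (ι i) ^ 2 / ∑ q, 𝒟 q ^ 2 := by
  intro i hi
  have hδ : 0 < 1 - δ := by linarith
  have hk' : (0 : ℝ) < k := by exact_mod_cast hk
  have hn' : (0 : ℝ) < n := by exact_mod_cast hn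
  have hα' : 0 < α := by linarith
  rw [hx i] at hi
  have hDi : 0 < D (V (ι i)) := hR0.trans_lt hi
  have h𝒟i : 0 < 𝒟 (ι i) := (mul_pos hδ hDi).trans_le (hclose (ι i)).1
  have hsum_pos : 0 < ∑ q, 𝒟 q ^ 2 :=
    Finset.sum_pos' (fun q _ => sq_nonneg _) ⟨ι i, Finset.mem_univ _, pow_pos h𝒟i 2⟩
  have hsum_le : ∑ q, 𝒟 q ^ 2 ≤ (1 + δ) ^ 2 * ∑ q, D (V q) ^ 2 := by
    rw [Finset.mul_sum]
    refine Finset.sum_le_sum fun q _ => ?_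
    rw [← mul_pow]
    exact pow_le_pow_left₀ (h𝒟0 q) (hclose q).2 2
  have hfar : ε ^ 3 / (246 * α * k * n) * ∑ q, D (V q) ^ 2 ≤ R ^ 2 := by
    calc ε ^ 3 / (246 * α * k * n) * ∑ q, D (V q) ^ 2
        = (ε ^ 2 / 41) * ((ε / (6 * α * k)) * ∑ q, D (V q) ^ 2) / n := by
          field_simp
          norm_num
      _ ≤ (ε ^ 2 / 41) * (∑ i, D (x i) ^ 2) / n := by gcongr
      _ = R ^ 2 := hR.symm
  have hfactor : (1 - δ) ^ 4 * (1 + δ) ^ 2 ≤ (1 - δ) ^ 2 := by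
    have h : (1 - δ) * (1 + δ) ≤ 1 := by nlinarith
    have h' : ((1 - δ) * (1 + δ)) ^ 2 ≤ 1 := pow_le_one₀ (by positivity) h
    calc (1 - δ) ^ 4 * (1 + δ) ^ 2 = (1 - δ) ^ 2 * ((1 - δ) * (1 + δ)) ^ 2 := by ring
      _ ≤ (1 - δ) ^ 2 := mul_le_of_le_one_right (by positivity) h'
  rw [le_div_iff₀ hsum_pos]
  calc (1 - δ) ^ 4 * ε ^ 3 / (246 * α * k * n) * ∑ q, 𝒟 q ^ 2
      ≤ (1 - δ) ^ 4 * ε ^ 3 / (246 * α * k * n) *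
          ((1 + δ) ^ 2 * ∑ q, D (V q) ^ 2) := by gcongr
    _ = ((1 - δ) ^ 4 * (1 + δ) ^ 2) *
          (ε ^ 3 / (246 * α * k * n) * ∑ q, D (V q) ^ 2) := by ring
    _ ≤ (1 - δ) ^ 2 * R ^ 2 := by gcongr
    _ ≤ (1 - δ) ^ 2 * D (V (ι i)) ^ 2 := by gcongr
    _ = ((1 - δ) * D (V (ι i))) ^ 2 := by ring
    _ ≤ 𝒟 (ι i) ^ 2 := by
      gcongr
      exact (hclose (ι i)).1
end
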